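/- Let F = {f_1,…,f_N} be a post-critically finite IFS of contracting similitudes with ratios r_i ∈ (0,1) on a complete metric space (X,d), with attractor K, satisfying the single intersection condition and the angle separation condition. Then there exists a constant c_3 > 0 such that for all x, y ∈ Σ_K, c_3^{-1}·ρ_K(x,y) ≤ d(π_K(x), π_K(y)) ≤ c_3·ρ_K(x,y), where ρ_K is the separation-prefix function defined in the context (and ρ_K(x,x) = 0). -/

import Mathlib

open Set Metric
open scoped ENNReal

/-- `wordMap f [i₁,…,i_k] = f i₁ ∘ ⋯ ∘ f i_k`. -/
def wordMap {X : Type*} {ι : Type*} (f : ι → X → X) : List ι → X → X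
  | [] => id
  | i :: I => f i ∘ wordMap f I

/-- The prefix word `x₁ ⋯ x_n` of an infinite word `x`. -/
def pre {ι : Type*} (x : ℕ → ι) (n : ℕ) : List ι := List.ofFn (fun j : Fin n => x j)

/-- `K` is the attractor of the IFS `f`: the (unique) nonempty compact set with
`K = ⋃ i, f i '' K`. -/
def IsAttractor {X : Type*} [MetricSpace X] {ι : Type*} (f : ι → X → X) (K : Set X) : Prop :=
  K.Nonempty ∧ IsCompact K ∧ K = ⋃ i, f i '' K

/-- `g` is a bi-Lipschitz contraction. -/
def IsBiLipContraction {X : Type*} [MetricSpace X] (g : X → X) : Prop :=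
  ∃ A B : ℝ, 0 < A ∧ B < 1 ∧ ∀ x y : X,
    A * dist x y ≤ dist (g x) (g y) ∧ dist (g x) (g y) ≤ B * dist x y

/-- `g` is a similitude of ratio `r`. -/
def IsSimilitude {X : Type*} [MetricSpace X] (g : X → X) (r : ℝ) : Prop :=
  ∀ x y : X, dist (g x) (g y) = r * dist x y

/-- The critical set `C_F = ⋃_{i ≠ j} f_i(K) ∩ f_j(K)`. -/
def criticalSet {X : Type*} {ι : Type*} (f : ι → X → X) (K : Set X) : Set X :=
  ⋃ (i : ι) (j : ι) (_ : i ≠ j), (f i '' K) ∩ (f j '' K)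

/-- The post-critical set `P_F = ⋃_{ω ∈ Σ^*} f_ω⁻¹(C_F) ∩ K`. -/
def postCriticalSet {X : Type*} {ι : Type*} (f : ι → X → X) (K : Set X) : Set X :=
  {p | p ∈ K ∧ ∃ I : List ι, I ≠ [] ∧ wordMap f I p ∈ criticalSet f K}

/-- `π` is the coding map of `(f, K)`: `{π x} = ⋂_k f_{x₁⋯x_k}(K)`. -/
def IsCodingMap {X : Type*} {ι : Type*} (f : ι → X → X) (K : Set X)
    (π : (ℕ → ι) → X) : Prop :=
  ∀ x : ℕ → ι, (⋂ k : ℕ, wordMap f (pre x (k + 1)) '' K) = {π x}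

/-- Single intersection condition: `f_i(K) ∩ f_j(K)` contains at most one point for `i ≠ j`. -/
def SIC {X : Type*} {ι : Type*} (f : ι → X → X) (K : Set X) : Prop :=
  ∀ i j : ι, i ≠ j → ((f i '' K) ∩ (f j '' K)).Subsingleton

/-- Angle separation condition with respect to a distance function `D`. -/
def ASCwrt {X : Type*} {ι : Type*} (f : ι → X → X) (K : Set X) (D : X → X → ℝ) : Prop :=
  ∃ c : ℝ, 0 < c ∧ ∀ i j : ι, i ≠ j → ∀ z : X, (f i '' K) ∩ (f j '' K) = {z} →
    ∀ x ∈ f i '' K, ∀ y ∈ f j '' K, c * max (D x z) (D y z) ≤ D x y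

/-- Angle separation condition. -/
def ASC {X : Type*} [MetricSpace X] {ι : Type*} (f : ι → X → X) (K : Set X) : Prop :=
  ASCwrt f K dist

/-- Lexicographic order on infinite words. -/
def lexLe {ι : Type*} [LinearOrder ι] (x y : ℕ → ι) : Prop :=
  x = y ∨ ∃ n : ℕ, (∀ k < n, x k = y k) ∧ x n < y n

/-- `Σ_K`: the set of lowest codings, i.e. of words that are lexicographically least
among all words with the same image under the coding map `π`. -/
def lowestCodings {X : Type*} {ι : Type*} [LinearOrder ι] (π : (ℕ → ι) → X) :
    Set (ℕ → ι) :=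
  {x | ∀ y : ℕ → ι, π y = π x → lexLe x y}

/-- `∂Σ_K`: the set of first letters of codings of post-critical points. -/
def bdryLetters {X : Type*} {ι : Type*} (f : ι → X → X) (K : Set X)
    (π : (ℕ → ι) → X) : Set ι :=
  {i | ∃ x : ℕ → ι, π x ∈ postCriticalSet f K ∧ x 0 = i}

/-- The contraction ratio `r_I = r_{i₁} ⋯ r_{i_k}` of a word. -/
def rword {ι : Type*} (r : ι → ℝ) (I : List ι) : ℝ := (I.map r).prod

theorem exists_pos_le_of_finite {ι : Type*} [Finite ι] (p : ι → ℝ → Prop)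
    (h : ∀ i, ∃ ε > 0, p i ε) (hp : ∀ i ε δ, δ ≤ ε → p i ε → p i δ) :
    ∃ ε > 0, ∀ i, p i ε := by
  choose g hg hpg using h
  cases isEmpty_or_nonempty ι with
  | inl _ => exact ⟨1, one_pos, fun i => isEmptyElim i⟩
  | inr _ =>
    obtain ⟨i₀, h₀⟩ := Finite.exists_min g
    exact ⟨g i₀, hg i₀, fun i => hp i _ _ (h₀ i) (hpg i)⟩

theorem IsCompact.exists_pos_le_dist_of_disjoint {X : Type*} [MetricSpace X] {s t : Set X}
    (hs : IsCompact s) (ht : IsCompact t) (h : s ∩ t = ∅) :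
    ∃ ε > 0, ∀ x ∈ s, ∀ y ∈ t, ε ≤ dist x y := by
  rcases (s ×ˢ t).eq_empty_or_nonempty with he | hne
  · refine ⟨1, one_pos, fun x hx y hy => ?_⟩
    exact absurd (show (x, y) ∈ s ×ˢ t from ⟨hx, hy⟩) (by simp [he])
  · obtain ⟨⟨a, b⟩, ⟨ha, hb⟩, hmin⟩ :=
      (hs.prod ht).exists_isMinOn hne (continuous_dist.continuousOn (s := s ×ˢ t))
    refine ⟨dist a b, dist_pos.2 ?_, fun x hx y hy => hmin (show (x, y) ∈ s ×ˢ t from ⟨hx, hy⟩)⟩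
    rintro rfl
    exact absurd (show a ∈ s ∩ t from ⟨ha, hb⟩) (by simp [h])

theorem wordMap_append {X ι : Type*} (f : ι → X → X) (I J : List ι) (p : X) :
    wordMap f (I ++ J) p = wordMap f I (wordMap f J p) := by
  induction I with
  | nil => rfl
  | cons i I ih => simp [wordMap, ih]

theorem pre_succ {ι : Type*} (x : ℕ → ι) (n : ℕ) : pre x (n + 1) = pre x n ++ [x n] := by
  rw [pre, List.ofFn_succ', List.concat_eq_append]
  rfl

theorem pre_add {ι : Type*} (x : ℕ → ι) (k m : ℕ) :
    pre x (k + m) = pre x k ++ pre (fun j => x (k + j)) m := by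
  induction m with
  | zero => simp [pre]
  | succ m ih => rw [← Nat.add_assoc, pre_succ, ih, pre_succ, List.append_assoc]

theorem pre_congr {ι : Type*} {x y : ℕ → ι} {k : ℕ} (h : ∀ j < k, x j = y j) :
    pre x k = pre y k := by
  unfold pre
  exact congrArg List.ofFn (funext fun j => h j j.2)

theorem wordMap_pre_succ_image {X ι : Type*} (f : ι → X → X) (K : Set X) (x : ℕ → ι) (n : ℕ) :
    wordMap f (pre x (n + 1)) '' K = wordMap f (pre x n) '' (f (x n) '' K) := by
  rw [pre_succ, image_image]
  exact image_congr fun p _ => by simp [wordMap_append, wordMap]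

theorem rword_pre_succ {ι : Type*} (r : ι → ℝ) (x : ℕ → ι) (n : ℕ) :
    rword r (pre x (n + 1)) = rword r (pre x n) * r (x n) := by
  simp [rword, pre_succ]

theorem rword_pos {ι : Type*} {r : ι → ℝ} (hr : ∀ i, 0 < r i) (I : List ι) : 0 < rword r I := by
  induction I with
  | nil => simp [rword]
  | cons i I ih => simpa [rword] using mul_pos (hr i) ih

theorem rword_pre_succ_le {ι : Type*} {r : ι → ℝ} (hr : ∀ i, 0 < r i ∧ r i < 1) (x : ℕ → ι)
    (n : ℕ) : rword r (pre x (n + 1)) ≤ rword r (pre x n) := by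
  rw [rword_pre_succ]
  exact mul_le_of_le_one_right (rword_pos (fun i => (hr i).1) _).le (hr _).2.le

theorem IsSimilitude.dist_wordMap {X ι : Type*} [MetricSpace X] {f : ι → X → X} {r : ι → ℝ}
    (hf : ∀ i, IsSimilitude (f i) (r i)) (I : List ι) (p q : X) :
    dist (wordMap f I p) (wordMap f I q) = rword r I * dist p q := by
  induction I with
  | nil => simp [rword, wordMap]
  | cons i I ih =>
    simp only [wordMap, Function.comp, rword, List.map_cons, List.prod_cons] at ih ⊢
    rw [hf i, ih, mul_assoc]

theorem IsSimilitude.injective_wordMap {X ι : Type*} [MetricSpace X] {f : ι → X → X} {r : ι → ℝ}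
    (hr : ∀ i, 0 < r i) (hf : ∀ i, IsSimilitude (f i) (r i)) (I : List ι) :
    Function.Injective (wordMap f I) := by
  intro p q h
  have h' := IsSimilitude.dist_wordMap hf I p q
  rw [h, dist_self] at h'
  exact dist_eq_zero.1 ((mul_eq_zero.1 h'.symm).resolve_left (rword_pos hr I).ne')

theorem IsSimilitude.continuous {X : Type*} [MetricSpace X] {g : X → X} {c : ℝ} (hc : 0 < c)
    (hg : IsSimilitude g c) : Continuous g :=
  (LipschitzWith.of_dist_le_mul (K := ⟨c, hc.le⟩) fun x y => (hg x y).le).continuous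

theorem IsAttractor.image_subset {X ι : Type*} [MetricSpace X] {f : ι → X → X} {K : Set X}
    (hK : IsAttractor f K) (i : ι) : f i '' K ⊆ K := by
  conv_rhs => rw [hK.2.2]
  exact subset_iUnion (fun i => f i '' K) i

theorem IsAttractor.antitone_wordMap_pre_image {X ι : Type*} [MetricSpace X] {f : ι → X → X}
    {K : Set X} (hK : IsAttractor f K) (x : ℕ → ι) :
    Antitone fun n => wordMap f (pre x n) '' K := by
  refine antitone_nat_of_succ_le fun n => ?_
  rw [wordMap_pre_succ_image]
  exact image_mono (hK.image_subset _)

theorem IsCodingMap.mem_wordMap_pre_image {X ι : Type*} [MetricSpace X] {f : ι → X → X}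
    {K : Set X} {π : (ℕ → ι) → X} (hK : IsAttractor f K) (hπ : IsCodingMap f K π) (x : ℕ → ι)
    (n : ℕ) : π x ∈ wordMap f (pre x n) '' K := by
  have h : π x ∈ ⋂ k : ℕ, wordMap f (pre x (k + 1)) '' K := by rw [hπ x]; rfl
  exact hK.antitone_wordMap_pre_image x n.le_succ (mem_iInter.1 h n)

theorem IsCodingMap.eq_of_forall_mem {X ι : Type*} {f : ι → X → X}
    {K : Set X} {π : (ℕ → ι) → X} (hπ : IsCodingMap f K π) {x : ℕ → ι}
    {a : X} (h : ∀ n, a ∈ wordMap f (pre x n) '' K) : a = π x := by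
  have h' : a ∈ ⋂ k : ℕ, wordMap f (pre x (k + 1)) '' K := mem_iInter.2 fun k => h _
  rwa [hπ x] at h'

theorem IsCodingMap.exists_eq {X ι : Type*} [MetricSpace X] {f : ι → X → X}
    {K : Set X} {π : (ℕ → ι) → X} (hK : IsAttractor f K) (hπ : IsCodingMap f K π) {p : X}
    (hp : p ∈ K) : ∃ x, π x = p := by
  have hstep : ∀ q : K, ∃ i : ι, ∃ q' : K, f i q' = q := by
    rintro ⟨q, hq⟩
    rw [hK.2.2] at hq
    obtain ⟨i, q', hq', h⟩ := mem_iUnion.1 hq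
    exact ⟨i, ⟨q', hq'⟩, h⟩
  choose g s hs using hstep
  refine ⟨fun n => g (s^[n] ⟨p, hp⟩), (hπ.eq_of_forall_mem fun n => ?_).symm⟩
  refine ⟨s^[n] ⟨p, hp⟩, Subtype.coe_prop _, ?_⟩
  induction n with
  | zero => rfl
  | succ n ih =>
    rw [pre_succ, wordMap_append, Function.iterate_succ_apply']
    simp only [wordMap, Function.comp, id]
    rw [hs, ih]

theorem eq_of_mem_lowestCodings {X ι : Type*} [LinearOrder ι] {π : (ℕ → ι) → X} {x y : ℕ → ι}
    (hx : x ∈ lowestCodings π) (hy : y ∈ lowestCodings π) (h : π x = π y) : x = y := by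
  rcases hx y h.symm with h₁ | ⟨m, hm, hm'⟩
  · exact h₁
  rcases hy x h with h₁ | ⟨n, hn, hn'⟩
  · exact h₁.symm
  rcases lt_trichotomy m n with hlt | rfl | hlt
  · exact absurd hm' (by simp [hn m hlt])
  · exact absurd hm' hn'.not_gt
  · exact absurd hn' (by simp [hm n hlt])

/-- The level at which a coding leaves the cells containing a point other than the coded one. -/
theorem IsCodingMap.exists_isLeast {X ι : Type*} {f : ι → X → X}
    {K : Set X} {π : (ℕ → ι) → X} (hπ : IsCodingMap f K π) {x : ℕ → ι} {a : X} (h : a ≠ π x) :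
    ∃ m, IsLeast {t : ℕ | a ∉ wordMap f (pre x t) '' K} m := by
  classical
  have hex : ∃ t, a ∉ wordMap f (pre x t) '' K := by
    by_contra! hall
    exact h (hπ.eq_of_forall_mem hall)
  exact ⟨Nat.find hex, Nat.find_spec hex, fun t ht => Nat.find_min' hex ht⟩

theorem postCriticalSet_finite {X ι : Type*} [MetricSpace X] {f : ι → X → X}
    {K : Set X} {π : (ℕ → ι) → X} (hK : IsAttractor f K) (hπ : IsCodingMap f K π)
    (hpcf : (π ⁻¹' postCriticalSet f K).Finite) : (postCriticalSet f K).Finite := by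
  refine (hpcf.image π).subset fun p hp => ?_
  obtain ⟨x, rfl⟩ := hπ.exists_eq hK hp.1
  exact ⟨x, hp, rfl⟩

/-- If the coding `x` leaves the cells containing `a` at level `m`, then the distance from `π x`
to `a` is at most comparable to the ratio of the level `m` cell. -/
theorem exists_dist_le_mul_rword {X ι : Type*} [MetricSpace X] [Finite ι] {f : ι → X → X}
    {r : ι → ℝ} {K : Set X} {π : (ℕ → ι) → X} (hr : ∀ i, 0 < r i)
    (hf : ∀ i, IsSimilitude (f i) (r i)) (hK : IsAttractor f K) (hπ : IsCodingMap f K π) :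
    ∃ U > 0, ∀ (x : ℕ → ι) (a : X) (m : ℕ), a ∈ wordMap f (pre x m) '' K →
      dist (π x) a ≤ U * rword r (pre x (m + 1)) := by
  obtain ⟨s, hs, hsr⟩ := exists_pos_le_of_finite (fun i ε => ε ≤ r i)
    (fun i => ⟨r i, hr i, le_rfl⟩) (fun i ε δ h h' => h.trans h')
  have hD : 0 < diam K + 1 := by positivity
  refine ⟨(diam K + 1) / s, by positivity, ?_⟩
  rintro x _ m ⟨b, hb, rfl⟩
  obtain ⟨q, hq, hqx⟩ := hπ.mem_wordMap_pre_image hK x m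
  rw [← hqx, IsSimilitude.dist_wordMap hf, rword_pre_succ]
  have hd : dist q b ≤ diam K + 1 :=
    (dist_le_diam_of_mem hK.2.1.isBounded hq hb).trans (by linarith)
  have hR := rword_pos hr (pre x m)
  calc rword r (pre x m) * dist q b ≤ rword r (pre x m) * (diam K + 1) := by gcongr
    _ = (diam K + 1) / s * (rword r (pre x m) * s) := by field_simp
    _ ≤ _ := by gcongr; exact hsr _

/-- If `a` is the image of a critical point and the coding `x` leaves the cells containing `a` at
level `m`, then the distance from `π x` to `a` is at least comparable to the ratio of the
level `m` cell. -/
theorem exists_mul_rword_le_dist {X ι : Type*} [MetricSpace X] [Finite ι] {f : ι → X → X}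
    {r : ι → ℝ} {K : Set X} {π : (ℕ → ι) → X} (hr : ∀ i, 0 < r i ∧ r i < 1)
    (hf : ∀ i, IsSimilitude (f i) (r i)) (hK : IsAttractor f K) (hπ : IsCodingMap f K π)
    (hP : (postCriticalSet f K).Finite) :
    ∃ δ > 0, ∀ (x : ℕ → ι) (k m : ℕ), ∀ z ∈ criticalSet f K,
      wordMap f (pre x k) z ∈ wordMap f (pre x (k + 1 + m)) '' K →
      wordMap f (pre x k) z ∉ wordMap f (pre x (k + 1 + m + 1)) '' K →
      δ * rword r (pre x (k + 1 + m + 1)) ≤ dist (π x) (wordMap f (pre x k) z) := by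
  have hr' := fun i => (hr i).1
  have : Finite (postCriticalSet f K) := hP
  obtain ⟨δ, hδ, hδd⟩ := exists_pos_le_of_finite
    (fun (i : postCriticalSet f K × ι) ε => i.1.1 ∉ f i.2 '' K → ∀ q ∈ f i.2 '' K, ε ≤ dist q i.1.1)
    (by
      rintro ⟨⟨b, hb⟩, i⟩
      by_cases hbi : b ∈ f i '' K
      · exact ⟨1, one_pos, fun h => absurd hbi h⟩
      · obtain ⟨ε, hε, h⟩ := IsCompact.exists_pos_le_dist_of_disjoint
          (hK.2.1.image ((hf i).continuous (hr' i))) (isCompact_singleton (x := b))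
          (inter_singleton_eq_empty.2 hbi)
        exact ⟨ε, hε, fun _ q hq => h q hq b rfl⟩)
    (fun i ε δ h h' hn q hq => h.trans (h' hn q hq))
  refine ⟨δ, hδ, fun x k m z hz hmem hnot => ?_⟩
  obtain ⟨b, hb, hba⟩ := hmem
  have hbP : b ∈ postCriticalSet f K := by
    refine ⟨hb, pre (fun j => x (k + j)) (1 + m), by simp [pre], ?_⟩
    rw [Nat.add_assoc, pre_add, wordMap_append] at hba
    rwa [IsSimilitude.injective_wordMap hr' hf _ hba]
  rw [← hba, wordMap_pre_succ_image,
    (IsSimilitude.injective_wordMap hr' hf _).mem_set_image] at hnot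
  have hx := hπ.mem_wordMap_pre_image hK x (k + 1 + m + 1)
  rw [wordMap_pre_succ_image] at hx
  obtain ⟨q, hq, hqx⟩ := hx
  rw [← hba, ← hqx, IsSimilitude.dist_wordMap hf]
  have h₁ := hδd (⟨b, hbP⟩, x (k + 1 + m)) hnot q hq
  have h₂ := rword_pre_succ_le hr x (k + 1 + m)
  have h₃ := rword_pos hr' (pre x (k + 1 + m))
  calc δ * rword r (pre x (k + 1 + m + 1)) ≤ δ * rword r (pre x (k + 1 + m)) := by gcongr
    _ = rword r (pre x (k + 1 + m)) * δ := mul_comm _ _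
    _ ≤ _ := by gcongr

/-- **Lemma (the separation-prefix function is comparable to the metric).**
Let `F` be a p.c.f. IFS of contracting similitudes satisfying the SIC and the ASC, and let
`ρ` be the separation-prefix function on `Σ_K` (characterized by the hypotheses `hρdiag`,
`hρ₁`–`hρ₄` below, following the three cases of the definition of the separation prefix).
Then there is `c₃ > 0` with `c₃⁻¹ ρ(x,y) ≤ d(π x, π y) ≤ c₃ ρ(x,y)` on `Σ_K`. -/
theorem separation_prefix_comparable_to_dist
    {X : Type*} [MetricSpace X] [CompleteSpace X]
    {N : ℕ} (f : Fin N → X → X) (r : Fin N → ℝ) (K : Set X) (π : (ℕ → Fin N) → X)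
    (hr : ∀ i, 0 < r i ∧ r i < 1) (hf : ∀ i, IsSimilitude (f i) (r i))
    (hK : IsAttractor f K) (hπ : IsCodingMap f K π)
    (hpcf : (π ⁻¹' postCriticalSet f K).Finite)
    (hSIC : SIC f K) (hASC : ASC f K)
    (ρ : (ℕ → Fin N) → (ℕ → Fin N) → ℝ)
    (hρdiag : ∀ x, ρ x x = 0)
    (hρ₁ : ∀ x ∈ lowestCodings π, ∀ y ∈ lowestCodings π, ∀ k : ℕ,
      (∀ j < k, x j = y j) → x k ≠ y k →
      (wordMap f (pre x (k + 1)) '' K) ∩ (wordMap f (pre y (k + 1)) '' K) = ∅ →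
      ρ x y = max (rword r (pre x (k + 1))) (rword r (pre y (k + 1))))
    (hρ₂ : ∀ x ∈ lowestCodings π, ∀ y ∈ lowestCodings π, ∀ k : ℕ,
      (∀ j < k, x j = y j) → x k ≠ y k → ∀ a : X,
      (wordMap f (pre x (k + 1)) '' K) ∩ (wordMap f (pre y (k + 1)) '' K) = {a} →
      a ≠ π x → a ≠ π y → ∀ m n : ℕ,
      IsLeast {t : ℕ | a ∉ wordMap f (pre x t) '' K} m →
      IsLeast {t : ℕ | a ∉ wordMap f (pre y t) '' K} n →
      ρ x y = max (rword r (pre x m)) (rword r (pre y n)))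
    (hρ₃ : ∀ x ∈ lowestCodings π, ∀ y ∈ lowestCodings π, ∀ k : ℕ,
      (∀ j < k, x j = y j) → x k ≠ y k → ∀ a : X,
      (wordMap f (pre x (k + 1)) '' K) ∩ (wordMap f (pre y (k + 1)) '' K) = {a} →
      a = π x → ∀ n : ℕ,
      IsLeast {t : ℕ | a ∉ wordMap f (pre y t) '' K} n →
      ρ x y = rword r (pre y n))
    (hρ₄ : ∀ x ∈ lowestCodings π, ∀ y ∈ lowestCodings π, ∀ k : ℕ,
      (∀ j < k, x j = y j) → x k ≠ y k → ∀ a : X,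
      (wordMap f (pre x (k + 1)) '' K) ∩ (wordMap f (pre y (k + 1)) '' K) = {a} →
      a = π y → ∀ m : ℕ,
      IsLeast {t : ℕ | a ∉ wordMap f (pre x t) '' K} m →
      ρ x y = rword r (pre x m)) :
    ∃ c₃ : ℝ, 0 < c₃ ∧ ∀ x ∈ lowestCodings π, ∀ y ∈ lowestCodings π,
      c₃⁻¹ * ρ x y ≤ dist (π x) (π y) ∧ dist (π x) (π y) ≤ c₃ * ρ x y := by
  have hr' := fun i => (hr i).1
  have hinj := IsSimilitude.injective_wordMap hr' hf
  have hanti := hK.antitone_wordMap_pre_image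
  have hmemπ := hπ.mem_wordMap_pre_image hK
  obtain ⟨U, hU, hupper⟩ := exists_dist_le_mul_rword hr' hf hK hπ
  obtain ⟨δ, hδ, hlower⟩ := exists_mul_rword_le_dist hr hf hK hπ (postCriticalSet_finite hK hπ hpcf)
  obtain ⟨η, hη, hsep⟩ := exists_pos_le_of_finite
    (fun (i : Fin N × Fin N) ε => (f i.1 '' K) ∩ (f i.2 '' K) = ∅ →
      ∀ p ∈ f i.1 '' K, ∀ q ∈ f i.2 '' K, ε ≤ dist p q)
    (by
      rintro ⟨i, j⟩
      by_cases hij : (f i '' K) ∩ (f j '' K) = ∅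
      · obtain ⟨ε, hε, h⟩ := IsCompact.exists_pos_le_dist_of_disjoint
          (hK.2.1.image ((hf i).continuous (hr' i))) (hK.2.1.image ((hf j).continuous (hr' j))) hij
        exact ⟨ε, hε, fun _ => h⟩
      · exact ⟨1, one_pos, fun h => absurd h hij⟩)
    (fun i ε δ h h' hij p hp q hq => h.trans (h' hij p hp q hq))
  obtain ⟨c, hc, hangle⟩ := hASC
  suffices H : ∃ e > 0, ∃ V > 0, ∀ x ∈ lowestCodings π, ∀ y ∈ lowestCodings π, x ≠ y →
      e * ρ x y ≤ dist (π x) (π y) ∧ dist (π x) (π y) ≤ V * ρ x y by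
    obtain ⟨e, he, V, hV, H⟩ := H
    refine ⟨e⁻¹ + V, by positivity, fun x hx y hy => ?_⟩
    by_cases hxy : x = y
    · simp [hxy, hρdiag]
    obtain ⟨h₁, h₂⟩ := H x hx y hy hxy
    have hρ : 0 ≤ ρ x y := nonneg_of_mul_nonneg_right (dist_nonneg.trans h₂) hV
    have hinv : (e⁻¹ + V)⁻¹ ≤ e := inv_le_of_inv_le₀ he (by linarith)
    have he' : 0 < e⁻¹ := inv_pos.2 he
    exact ⟨(mul_le_mul_of_nonneg_right hinv hρ).trans h₁,
      h₂.trans (mul_le_mul_of_nonneg_right (by linarith) hρ)⟩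
  refine ⟨min η (c * δ), by positivity, 2 * U, by positivity, fun x hx y hy hxy => ?_⟩
  have hne : π x ≠ π y := fun h => hxy (eq_of_mem_lowestCodings hx hy h)
  obtain ⟨k, hkne, hk⟩ : ∃ k, x k ≠ y k ∧ ∀ j < k, x j = y j := by
    classical
    have hex := Function.ne_iff.1 hxy
    exact ⟨Nat.find hex, Nat.find_spec hex, fun j hj => not_not.1 (Nat.find_min hex hj)⟩
  have hpre := pre_congr hk
  have hinter : (wordMap f (pre x (k + 1)) '' K) ∩ (wordMap f (pre y (k + 1)) '' K)
      = wordMap f (pre x k) '' ((f (x k) '' K) ∩ (f (y k) '' K)) := by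
    rw [wordMap_pre_succ_image, wordMap_pre_succ_image, ← hpre, image_inter (hinj _)]
  obtain ⟨p, hp, hpx⟩ : π x ∈ wordMap f (pre x k) '' (f (x k) '' K) :=
    wordMap_pre_succ_image f K x k ▸ hmemπ x (k + 1)
  obtain ⟨q, hq, hqy⟩ : π y ∈ wordMap f (pre x k) '' (f (y k) '' K) :=
    hpre ▸ wordMap_pre_succ_image f K y k ▸ hmemπ y (k + 1)
  have hR := rword_pos hr' (pre x k)
  have hlevel : ∀ (w : ℕ → Fin N) (a : X) (m : ℕ), a ∈ wordMap f (pre w (k + 1)) '' K →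
      IsLeast {t : ℕ | a ∉ wordMap f (pre w t) '' K} m →
      ∃ l, m = k + 1 + l + 1 ∧ a ∈ wordMap f (pre w (k + 1 + l)) '' K := by
    intro w a m ha hm
    have hlt : k + 1 < m := by
      by_contra! hle
      exact hm.1 (hanti w hle ha)
    obtain ⟨l, rfl⟩ := Nat.exists_eq_add_of_lt hlt
    refine ⟨l, rfl, ?_⟩
    by_contra hn
    exact absurd (hm.2 hn) (by omega)
  have hboth : ∀ (w : ℕ → Fin N), pre w k = pre x k → ∀ z ∈ criticalSet f K,
      wordMap f (pre x k) z ∈ wordMap f (pre w (k + 1)) '' K → ∀ m,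
      IsLeast {t : ℕ | wordMap f (pre x k) z ∉ wordMap f (pre w t) '' K} m →
      δ * rword r (pre w m) ≤ dist (π w) (wordMap f (pre x k) z) ∧
        dist (π w) (wordMap f (pre x k) z) ≤ U * rword r (pre w m) := by
    intro w hw z hz hzw m hm
    obtain ⟨l, rfl, hl⟩ := hlevel w _ m hzw hm
    refine ⟨?_, hupper w _ _ hl⟩
    rw [← hw] at hl ⊢
    exact hlower w k l z hz hl (by rw [hw]; exact hm.1)
  have hmin₁ : min η (c * δ) ≤ η := min_le_left _ _
  have hmin₂ : min η (c * δ) ≤ c * δ := min_le_right _ _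
  rcases (hSIC _ _ hkne).eq_empty_or_singleton with he | ⟨z, hz⟩
  · rw [hρ₁ x hx y hy k hk hkne (by rw [hinter, he, image_empty])]
    have hx₁ := rword_pre_succ_le hr x k
    have hy₁ := rword_pre_succ_le hr y k
    rw [← hpre] at hy₁
    have hpos := rword_pos hr' (pre x (k + 1))
    have hu := hupper x (π y) k (by rw [hpre]; exact hmemπ y k)
    constructor
    · rw [← hpx, ← hqy, IsSimilitude.dist_wordMap hf, mul_comm]
      exact mul_le_mul (max_le hx₁ hy₁) (hmin₁.trans (hsep (x k, y k) he p hp q hq))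
        (by positivity) hR.le
    · refine hu.trans ?_
      have := le_max_left (rword r (pre x (k + 1))) (rword r (pre y (k + 1)))
      nlinarith
  · have hsing : (wordMap f (pre x (k + 1)) '' K) ∩ (wordMap f (pre y (k + 1)) '' K)
        = {wordMap f (pre x k) z} := by rw [hinter, hz, image_singleton]
    have hzmem : z ∈ (f (x k) '' K) ∩ (f (y k) '' K) := by rw [hz]; rfl
    have hzcrit : z ∈ criticalSet f K := by
      simp only [criticalSet, mem_iUnion]
      exact ⟨x k, y k, hkne, hzmem⟩
    obtain ⟨a, ha⟩ : ∃ a, a = wordMap f (pre x k) z := ⟨_, rfl⟩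
    rw [← ha] at hsing
    have hamem : a ∈ (wordMap f (pre x (k + 1)) '' K) ∩ (wordMap f (pre y (k + 1)) '' K) := by
      rw [hsing]; rfl
    have hax := hboth x rfl z hzcrit (ha ▸ hamem.1)
    have hay := hboth y hpre.symm z hzcrit (ha ▸ hamem.2)
    rw [← ha] at hax hay
    have hang : c * max (dist (π x) a) (dist (π y) a) ≤ dist (π x) (π y) := by
      rw [← hpx, ← hqy, ha, IsSimilitude.dist_wordMap hf, IsSimilitude.dist_wordMap hf,
        IsSimilitude.dist_wordMap hf, ← mul_max_of_nonneg _ _ hR.le, mul_left_comm]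
      exact mul_le_mul_of_nonneg_left (hangle _ _ hkne z hz p hp q hq) hR.le
    have hangx : c * dist (π x) a ≤ dist (π x) (π y) :=
      (mul_le_mul_of_nonneg_left (le_max_left _ _) hc.le).trans hang
    have hangy : c * dist (π y) a ≤ dist (π x) (π y) :=
      (mul_le_mul_of_nonneg_left (le_max_right _ _) hc.le).trans hang
    have hconv : ∀ (w : ℕ → Fin N) (m : ℕ), δ * rword r (pre w m) ≤ dist (π w) a →
        c * dist (π w) a ≤ dist (π x) (π y) →
        min η (c * δ) * rword r (pre w m) ≤ dist (π x) (π y) := by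
      intro w m h₁ h₂
      calc min η (c * δ) * rword r (pre w m) ≤ c * δ * rword r (pre w m) :=
            mul_le_mul_of_nonneg_right hmin₂ (rword_pos hr' _).le
        _ = c * (δ * rword r (pre w m)) := mul_assoc _ _ _
        _ ≤ c * dist (π w) a := mul_le_mul_of_nonneg_left h₁ hc.le
        _ ≤ _ := h₂
    by_cases hxa : a = π x
    · obtain ⟨n, hn⟩ := hπ.exists_isLeast (x := y) (a := a) (by rwa [hxa])
      rw [hρ₃ x hx y hy k hk hkne a hsing hxa n hn]
      obtain ⟨h₁, h₂⟩ := hay n hn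
      refine ⟨hconv y n h₁ hangy, ?_⟩
      rw [hxa, dist_comm] at h₂
      have := dist_nonneg.trans h₂
      linarith
    obtain ⟨m, hm⟩ := hπ.exists_isLeast hxa
    obtain ⟨h₁, h₂⟩ := hax m hm
    by_cases hya : a = π y
    · rw [hρ₄ x hx y hy k hk hkne a hsing hya m hm]
      refine ⟨hconv x m h₁ hangx, ?_⟩
      rw [hya] at h₂
      have := dist_nonneg.trans h₂
      linarith
    obtain ⟨n, hn⟩ := hπ.exists_isLeast hya
    obtain ⟨h₃, h₄⟩ := hay n hn
    rw [hρ₂ x hx y hy k hk hkne a hsing hxa hya m n hm hn]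
    constructor
    · rw [mul_max_of_nonneg _ _ (by positivity)]
      exact max_le (hconv x m h₁ hangx) (hconv y n h₃ hangy)
    · have htri := dist_triangle_right (π x) (π y) a
      have hx₂ := mul_le_mul_of_nonneg_left
        (le_max_left (rword r (pre x m)) (rword r (pre y n))) hU.le
      have hy₂ := mul_le_mul_of_nonneg_left
        (le_max_right (rword r (pre x m)) (rword r (pre y n))) hU.le
      linarith
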